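/- Let Q be an n×n real matrix, R a k×k real symmetric positive definite matrix, γ ≠ 0, g an n×k real matrix, σ' an m×n real matrix, ε' ∈ ℝⁿ (a row vector), f, ζ ∈ ℝⁿ, and W, Ŵ_c, Ŵ_{a1}, Ŵ_{a2} ∈ ℝᵐ. Define u₁* = −(1/2)R⁻¹gᵀ(σ'ᵀW + ε'ᵀ), u₂* = (1/(2γ²))gᵀ(σ'ᵀW + ε'ᵀ), û₁ = −(1/2)R⁻¹gᵀσ'ᵀŴ_{a1}, û₂ = (1/(2γ²))gᵀσ'ᵀŴ_{a2}, ω = σ'(f + g(û₁ + û₂)), G₁ = gR⁻¹gᵀ, G₂ = γ⁻²ggᵀ, G_{σ1} = σ'G₁σ'ᵀ, G_{σ2} = σ'G₂σ'ᵀ, W̃_c = W − Ŵ_c, W̃_{a1} = W − Ŵ_{a1}, W̃_{a2} = W − Ŵ_{a2}, H = ζᵀQζ + u₁*ᵀRu₁* − γ²u₂*ᵀu₂* + (Wᵀσ' + ε')·(f + g(u₁* + u₂*)), and δ = ζᵀQζ + û₁ᵀRû₁ − γ²û₂ᵀû₂ + Ŵ_cᵀω − H. Then δ = −W̃_cᵀω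 − ε'·f + (1/4)ε'G₁ε'ᵀ − (1/4)ε'G₂ε'ᵀ + (1/2)ε'G₁σ'ᵀW − (1/2)ε'G₂σ'ᵀW + (1/4)W̃_{a1}ᵀG_{σ1}W̃_{a1} − (1/4)W̃_{a2}ᵀG_{σ2}W̃_{a2}. -/

import Mathlib

open Matrix

/-- The unmeasurable form of the Bellman error (equation (22) of the paper):
with value-function gradient `Wᵀσ' + ε'`, optimal policies
`u₁* = −(1/2)R⁻¹gᵀ(σ'ᵀW + ε'ᵀ)`, `u₂* = (1/(2γ²))gᵀ(σ'ᵀW + ε'ᵀ)`,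
approximate policies `û₁ = −(1/2)R⁻¹gᵀσ'ᵀŴ_{a1}`, `û₂ = (1/(2γ²))gᵀσ'ᵀŴ_{a2}`,
regressor `ω = σ'(f + g(û₁+û₂))`, and Bellman error `δ = Ĥ − H`, one has
`δ = −W̃_cᵀω − ε'f + (1/4)ε'G₁ε'ᵀ − (1/4)ε'G₂ε'ᵀ + (1/2)ε'G₁σ'ᵀW
  − (1/2)ε'G₂σ'ᵀW + (1/4)W̃_{a1}ᵀG_{σ1}W̃_{a1} − (1/4)W̃_{a2}ᵀG_{σ2}W̃_{a2}`. -/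
theorem bellman_error_unmeasurable_form {n k m : ℕ}
    (Q : Matrix (Fin n) (Fin n) ℝ)
    (R : Matrix (Fin k) (Fin k) ℝ) (hRs : R.IsSymm) (hR : R.PosDef)
    (γ : ℝ) (hγ : γ ≠ 0)
    (g : Matrix (Fin n) (Fin k) ℝ) (σ' : Matrix (Fin m) (Fin n) ℝ)
    (ε' f ζ : Fin n → ℝ) (W Wc Wa1 Wa2 : Fin m → ℝ)
    (u1s u2s uh1 uh2 : Fin k → ℝ)
    (hu1s : u1s = (-(1 / 2) : ℝ) • (R⁻¹ *ᵥ (gᵀ *ᵥ (σ'ᵀ *ᵥ W + ε'))))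
    (hu2s : u2s = (1 / (2 * γ ^ 2)) • (gᵀ *ᵥ (σ'ᵀ *ᵥ W + ε')))
    (huh1 : uh1 = (-(1 / 2) : ℝ) • (R⁻¹ *ᵥ (gᵀ *ᵥ (σ'ᵀ *ᵥ Wa1))))
    (huh2 : uh2 = (1 / (2 * γ ^ 2)) • (gᵀ *ᵥ (σ'ᵀ *ᵥ Wa2)))
    (ω : Fin m → ℝ) (hω : ω = σ' *ᵥ (f + g *ᵥ (uh1 + uh2)))
    (G1 G2 : Matrix (Fin n) (Fin n) ℝ)
    (hG1 : G1 = g * R⁻¹ * gᵀ) (hG2 : G2 = (γ ^ 2)⁻¹ • (g * gᵀ))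
    (Gσ1 Gσ2 : Matrix (Fin m) (Fin m) ℝ)
    (hGσ1 : Gσ1 = σ' * G1 * σ'ᵀ) (hGσ2 : Gσ2 = σ' * G2 * σ'ᵀ)
    (Wtc Wta1 Wta2 : Fin m → ℝ)
    (hWtc : Wtc = W - Wc) (hWta1 : Wta1 = W - Wa1) (hWta2 : Wta2 = W - Wa2)
    (H δ : ℝ)
    (hH : H = ζ ⬝ᵥ Q *ᵥ ζ + u1s ⬝ᵥ R *ᵥ u1s - γ ^ 2 * (u2s ⬝ᵥ u2s)
        + (σ'ᵀ *ᵥ W + ε') ⬝ᵥ (f + g *ᵥ (u1s + u2s)))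
    (hδ : δ = ζ ⬝ᵥ Q *ᵥ ζ + uh1 ⬝ᵥ R *ᵥ uh1 - γ ^ 2 * (uh2 ⬝ᵥ uh2)
        + Wc ⬝ᵥ ω - H) :
    δ = -(Wtc ⬝ᵥ ω) - ε' ⬝ᵥ f
        + (1 / 4) * (ε' ⬝ᵥ G1 *ᵥ ε') - (1 / 4) * (ε' ⬝ᵥ G2 *ᵥ ε')
        + (1 / 2) * (ε' ⬝ᵥ G1 *ᵥ (σ'ᵀ *ᵥ W)) - (1 / 2) * (ε' ⬝ᵥ G2 *ᵥ (σ'ᵀ *ᵥ W))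
        + (1 / 4) * (Wta1 ⬝ᵥ Gσ1 *ᵥ Wta1) - (1 / 4) * (Wta2 ⬝ᵥ Gσ2 *ᵥ Wta2) := by
  have adj : ∀ {a b : ℕ} (A : Matrix (Fin a) (Fin b) ℝ) (x : Fin a → ℝ) (y : Fin b → ℝ),
      x ⬝ᵥ A *ᵥ y = (Aᵀ *ᵥ x) ⬝ᵥ y := by
    intro a b A x y
    rw [dotProduct_mulVec, mulVec_transpose]
  have hdet : IsUnit R.det := hR.det_pos.ne'.isUnit
  have hRR : ∀ x : Fin k → ℝ, R *ᵥ (R⁻¹ *ᵥ x) = x := by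
    intro x
    rw [mulVec_mulVec, mul_nonsing_inv R hdet, one_mulVec]
  have hSs : (R⁻¹)ᵀ = R⁻¹ := by
    rw [transpose_nonsing_inv, hRs.eq]
  have hsymm : ∀ x y : Fin k → ℝ, x ⬝ᵥ R⁻¹ *ᵥ y = y ⬝ᵥ R⁻¹ *ᵥ x := by
    intro x y
    rw [adj, hSs, dotProduct_comm]
  have hG1' : ∀ x y : Fin n → ℝ, x ⬝ᵥ G1 *ᵥ y = (gᵀ *ᵥ x) ⬝ᵥ R⁻¹ *ᵥ (gᵀ *ᵥ y) := by
    intro x y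
    rw [hG1, ← mulVec_mulVec, ← mulVec_mulVec, adj g]
  have hG2' : ∀ x y : Fin n → ℝ, x ⬝ᵥ G2 *ᵥ y = (γ ^ 2)⁻¹ * ((gᵀ *ᵥ x) ⬝ᵥ (gᵀ *ᵥ y)) := by
    intro x y
    rw [hG2, smul_mulVec, ← mulVec_mulVec, dotProduct_smul, adj g, smul_eq_mul]
  have hGσ1' : ∀ x : Fin m → ℝ, x ⬝ᵥ Gσ1 *ᵥ x = (σ'ᵀ *ᵥ x) ⬝ᵥ G1 *ᵥ (σ'ᵀ *ᵥ x) := by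
    intro x
    rw [hGσ1, ← mulVec_mulVec, ← mulVec_mulVec, adj σ']
  have hGσ2' : ∀ x : Fin m → ℝ, x ⬝ᵥ Gσ2 *ᵥ x = (σ'ᵀ *ᵥ x) ⬝ᵥ G2 *ᵥ (σ'ᵀ *ᵥ x) := by
    intro x
    rw [hGσ2, ← mulVec_mulVec, ← mulVec_mulVec, adj σ']
  have hWω : W ⬝ᵥ ω = (σ'ᵀ *ᵥ W) ⬝ᵥ f + (gᵀ *ᵥ (σ'ᵀ *ᵥ W)) ⬝ᵥ uh1
      + (gᵀ *ᵥ (σ'ᵀ *ᵥ W)) ⬝ᵥ uh2 := by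
    rw [hω, adj σ', dotProduct_add, adj g, dotProduct_add, add_assoc]
  rw [hδ, hH, hGσ1', hGσ2', hG1', hG1', hG1', hG2', hG2', hG2', hWtc, hWta1, hWta2,
    sub_dotProduct, hWω, dotProduct_add _ f, adj g, hu1s, hu2s, huh1, huh2]
  simp only [mulVec_add, mulVec_sub, mulVec_smul, hRR, smul_add]
  generalize gᵀ *ᵥ (σ'ᵀ *ᵥ W) = p
  generalize gᵀ *ᵥ (σ'ᵀ *ᵥ Wa1) = a
  generalize gᵀ *ᵥ (σ'ᵀ *ᵥ Wa2) = b
  generalize gᵀ *ᵥ ε' = e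
  simp only [dotProduct_add, add_dotProduct, dotProduct_sub, sub_dotProduct, dotProduct_smul,
    smul_dotProduct, smul_eq_mul, dotProduct_comm (R⁻¹ *ᵥ _) _]
  rw [hsymm p e, hsymm p a, dotProduct_comm p e, dotProduct_comm p b]
  field_simp
  ring
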